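/- For all integers 2 ≤ m' ≤ m ≤ N', P(#{𝔭(u_1), …, 𝔭(u_{m'})} ≤ m' − 1) ≥ ((m')_2 / (m)_2) · P(#{𝔭(u_1), …, 𝔭(u_m)} ≤ m − 1), where (l)_2 = l(l−1). In words: the probability that among m' uniformly sampled distinct individuals at least two share a parent is at least (m'(m'−1))/(m(m−1)) times the corresponding probability for m sampled individuals. -/

import Mathlib

open MeasureTheory Finset
open scoped ENNReal

/-- The parent map associated with an offspring vector `v`. -/
noncomputable def parentMap (v : ℕ → ℕ) (c : ℕ) : ℕ :=
  sInf {i : ℕ | c < ∑ j ∈ Finset.range (i + 1), v j}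

/-- The value of a permutation of `Fin M` at position `i < M`, and `0` otherwise. -/
def permVal {M : ℕ} (e : Equiv.Perm (Fin M)) (i : ℕ) : ℕ :=
  if h : i < M then (e ⟨i, h⟩ : Fin M) else 0

/-- Collision among the first `m` sampled individuals. -/
def Coll {M : ℕ} (m : ℕ) (v : ℕ → ℕ) (e : Equiv.Perm (Fin M)) : Prop :=
  ∃ i, i < m ∧ ∃ j, j < m ∧ i ≠ j ∧ parentMap v (permVal e i) = parentMap v (permVal e j)

lemma measurable_parentMap (c : ℕ) : Measurable (fun v : ℕ → ℕ => parentMap v c) := by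
  have hS : ∀ i : ℕ, MeasurableSet {v : ℕ → ℕ | c < ∑ j ∈ Finset.range (i + 1), v j} := by
    intro i
    apply measurableSet_lt measurable_const
    exact Finset.measurable_sum _ (fun j _ => measurable_pi_apply j)
  apply measurable_to_countable'
  intro n
  have : (fun v : ℕ → ℕ => parentMap v c) ⁻¹' {n} =
      ({v | c < ∑ j ∈ Finset.range (n + 1), v j} ∩
        ⋂ k : ℕ, ⋂ _ : k < n, {v | c < ∑ j ∈ Finset.range (k + 1), v j}ᶜ) ∪
      ({v | n = 0} ∩ ⋂ k : ℕ, {v | c < ∑ j ∈ Finset.range (k + 1), v j}ᶜ) := by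
    ext v
    simp only [Set.mem_preimage, Set.mem_singleton_iff, Set.mem_union, Set.mem_inter_iff,
      Set.mem_iInter, Set.mem_compl_iff, Set.mem_setOf_eq]
    unfold parentMap
    constructor
    · intro h
      by_cases hne : {i : ℕ | c < ∑ j ∈ Finset.range (i + 1), v j}.Nonempty
      · left
        rw [← h]
        exact ⟨Nat.sInf_mem hne, fun k hk h' => Nat.notMem_of_lt_sInf
          (s := {i : ℕ | c < ∑ j ∈ Finset.range (i + 1), v j}) hk h'⟩
      · right
        rw [Set.not_nonempty_iff_eq_empty] at hne
        refine ⟨?_, fun k hk => ?_⟩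
        · rw [← h, hne]; simp
        · have : k ∈ {i : ℕ | c < ∑ j ∈ Finset.range (i + 1), v j} := hk
          rw [hne] at this; exact this
    · rintro (⟨h1, h2⟩ | ⟨h1, h2⟩)
      · apply le_antisymm
        · exact Nat.sInf_le h1
        · by_contra hlt
          exact h2 _ (not_le.mp hlt) (Nat.sInf_mem
            (s := {i : ℕ | c < ∑ j ∈ Finset.range (i + 1), v j}) ⟨n, h1⟩)
      · have : {i : ℕ | c < ∑ j ∈ Finset.range (i + 1), v j} = ∅ := by
          ext k; simpa using h2 k
        rw [this, h1]; simp
  rw [this]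
  refine MeasurableSet.union ((hS n).inter ?_) (MeasurableSet.inter (MeasurableSet.const _) ?_)
  · exact MeasurableSet.iInter fun k => MeasurableSet.iInter fun _ => (hS k).compl
  · exact MeasurableSet.iInter fun k => (hS k).compl

lemma measurableSet_coll {M : ℕ} (m : ℕ) (e : Equiv.Perm (Fin M)) :
    MeasurableSet {v : ℕ → ℕ | Coll m v e} := by
  have : {v : ℕ → ℕ | Coll m v e} = ⋃ i : ℕ, ⋃ j : ℕ, ({v | i < m ∧ j < m ∧ i ≠ j} ∩
      {v | parentMap v (permVal e i) = parentMap v (permVal e j)}) := by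
    ext v
    simp only [Coll, Set.mem_setOf_eq, Set.mem_iUnion, Set.mem_inter_iff]
    constructor
    · rintro ⟨i, hi, j, hj, hij, h⟩; exact ⟨i, j, ⟨hi, hj, hij⟩, h⟩
    · rintro ⟨i, j, ⟨hi, hj, hij⟩, h⟩; exact ⟨i, hi, j, hj, hij, h⟩
  rw [this]
  exact MeasurableSet.iUnion fun i => MeasurableSet.iUnion fun j =>
    (MeasurableSet.const _).inter
      (measurableSet_eq_fun (measurable_parentMap _) (measurable_parentMap _))

lemma card_le_iff_coll {M : ℕ} (m : ℕ) (hm : 0 < m) (v : ℕ → ℕ) (e : Equiv.Perm (Fin M)) :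
    ((Finset.range m).image (fun i => parentMap v (permVal e i))).card ≤ m - 1 ↔ Coll m v e := by
  have h1 := Finset.card_image_le (s := Finset.range m)
    (f := fun i => parentMap v (permVal e i))
  have h2 := Finset.card_image_iff (s := Finset.range m)
    (f := fun i => parentMap v (permVal e i))
  rw [Finset.card_range] at h1 h2
  have h3 : ((Finset.range m).image (fun i => parentMap v (permVal e i))).card ≤ m - 1 ↔
      ¬ ((Finset.range m).image (fun i => parentMap v (permVal e i))).card = m := by omega
  rw [h3, h2]
  unfold Set.InjOn Coll
  push Not
  simp only [Finset.coe_range, Set.mem_Iio]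
  constructor
  · rintro ⟨i, hi, j, hj, h, hij⟩; exact ⟨i, hi, j, hj, hij, h⟩
  · rintro ⟨i, hi, j, hj, hij, h⟩; exact ⟨i, hi, j, hj, h, hij⟩

/-- swap of positions `k`, `m` -/
def sw {M : ℕ} (k m : ℕ) : Equiv.Perm (Fin M) :=
  if h : k < M ∧ m < M then Equiv.swap ⟨k, h.1⟩ ⟨m, h.2⟩ else 1

lemma permVal_sw {M : ℕ} (e : Equiv.Perm (Fin M)) (k m i : ℕ) (hk : k < M) (hm : m < M)
    (hi : i < M) :
    permVal (e * sw k m) i = permVal e (if i = k then m else if i = m then k else i) := by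
  have h0 : (if i = k then m else if i = m then k else i) < M := by split_ifs <;> assumption
  unfold permVal sw
  rw [dif_pos hi, dif_pos h0, dif_pos ⟨hk, hm⟩]
  congr 1
  rw [Equiv.Perm.mul_apply]
  congr 1
  rw [Equiv.swap_apply_def]
  simp only [Fin.mk.injEq]
  split_ifs <;> rfl

lemma coll_card {M : ℕ} (m : ℕ) (hm : m < M) (v : ℕ → ℕ) (e : Equiv.Perm (Fin M))
    (h : Coll (m + 1) v e) :
    ∃ T ⊆ Finset.range (m + 1), T.card = m - 1 ∧ ∀ k ∈ T, Coll m v (e * sw k m) := by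
  obtain ⟨i, hi, j, hj, hij, h⟩ := h
  refine ⟨((Finset.range (m + 1)).erase i).erase j, ?_, ?_, ?_⟩
  · exact (Finset.erase_subset _ _).trans (Finset.erase_subset _ _)
  · rw [Finset.card_erase_of_mem, Finset.card_erase_of_mem, Finset.card_range]
    · omega
    · simpa using hi
    · simp only [Finset.mem_erase, Finset.mem_range]; omega
  · intro k hk
    simp only [Finset.mem_erase, Finset.mem_range] at hk
    have key : ∀ a, a < m + 1 → a ≠ k → (if a = m then k else a) < m ∧
        permVal (e * sw k m) (if a = m then k else a) = permVal e a := by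
      intro a ha hak
      have h1 : (if a = m then k else a) < m := by split_ifs <;> omega
      refine ⟨h1, ?_⟩
      rw [permVal_sw e k m _ (by omega) hm (by omega)]
      congr 1
      split_ifs <;> omega
    obtain ⟨a1, a2⟩ := key i hi (by omega)
    obtain ⟨b1, b2⟩ := key j hj (by omega)
    refine ⟨_, a1, _, b1, ?_, ?_⟩
    · split_ifs <;> omega
    · rw [a2, b2, h]

lemma step_one {Ω : Type*} [MeasurableSpace Ω] (P : Measure Ω)
    (ν : Ω → ℕ → ℕ) (hν : Measurable ν) {M : ℕ} (m : ℕ) (hm : m < M)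
    (e : Equiv.Perm (Fin M)) :
    ((m - 1 : ℕ) : ℝ≥0∞) * P (ν ⁻¹' {v | Coll (m + 1) v e}) ≤
      ∑ k ∈ Finset.range (m + 1), P (ν ⁻¹' {v | Coll m v (e * sw k m)}) := by
  have hA : ∀ m (e : Equiv.Perm (Fin M)), MeasurableSet (ν ⁻¹' {v | Coll m v e}) :=
    fun m e => hν (measurableSet_coll m e)
  simp_rw [← fun m e => lintegral_indicator_one (μ := P) (hA m e)]
  rw [← lintegral_const_mul _ (measurable_one.indicator (hA _ _)),
    ← lintegral_finsetSum _ (fun k _ => measurable_one.indicator (hA _ _))]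
  apply lintegral_mono
  intro ω
  by_cases h : Coll (m + 1) (ν ω) e
  · obtain ⟨T, hT, hc, hk⟩ := coll_card m hm _ _ h
    calc _ = ∑ k ∈ T, (1 : ℝ≥0∞) := by
          simp [Set.indicator, h, hc]
      _ = ∑ k ∈ T, (ν ⁻¹' {v | Coll m v (e * sw k m)}).indicator 1 ω := by
          apply Finset.sum_congr rfl
          intro k hkT
          simp [Set.indicator, hk k hkT]
      _ ≤ _ := Finset.sum_le_sum_of_subset hT
  · simp [Set.indicator, h]

lemma step_sum {Ω : Type*} [MeasurableSpace Ω] (P : Measure Ω)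
    (ν : Ω → ℕ → ℕ) (hν : Measurable ν) {M : ℕ} (m : ℕ) (hm : m < M) :
    ((m - 1 : ℕ) : ℝ≥0∞) * ∑ e : Equiv.Perm (Fin M), P (ν ⁻¹' {v | Coll (m + 1) v e}) ≤
      ((m + 1 : ℕ) : ℝ≥0∞) * ∑ e : Equiv.Perm (Fin M), P (ν ⁻¹' {v | Coll m v e}) := by
  rw [Finset.mul_sum]
  refine (Finset.sum_le_sum fun e _ => step_one P ν hν m hm e).trans ?_
  rw [Finset.sum_comm]
  have : ∀ k, ∑ e : Equiv.Perm (Fin M), P (ν ⁻¹' {v | Coll m v (e * sw k m)}) =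
      ∑ e : Equiv.Perm (Fin M), P (ν ⁻¹' {v | Coll m v e}) := fun k =>
    Equiv.sum_comp (Equiv.mulRight (sw k m)) (fun e => P (ν ⁻¹' {v | Coll m v e}))
  simp_rw [this]
  simp

/-- For `2 ≤ m' ≤ m ≤ N'`,
`P(#{𝔭(u_1),…,𝔭(u_{m'})} ≤ m'−1) ≥ ((m')_2/(m)_2) · P(#{𝔭(u_1),…,𝔭(u_m)} ≤ m−1)`.
(Indices of `u` are shifted to be `0`-based.) -/
theorem coalescent_collision_monotonicity
    {Ω : Type*} [MeasurableSpace Ω] (P : Measure Ω) [IsProbabilityMeasure P]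
    (N N' : ℕ) (hN : 0 < N) (hN' : 0 < N')
    (ν : Ω → ℕ → ℕ) (hνmeas : Measurable ν)
    (hsum : ∀ᵐ ω ∂P, ∑ i ∈ Finset.range N, ν ω i = N')
    (hexch : ∀ π : Equiv.Perm (Fin N),
      Measure.map (fun ω => fun i : Fin N => ν ω (π i)) P
        = Measure.map (fun ω => fun i : Fin N => ν ω i) P)
    (σ : Ω → Equiv.Perm (Fin N'))
    (hσmeas : ∀ e, MeasurableSet {ω | σ ω = e})
    (hσunif : ∀ e : Equiv.Perm (Fin N'),
      P {ω | σ ω = e} = 1 / (Nat.factorial N' : ℝ≥0∞))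
    (hindep : ∀ (e : Equiv.Perm (Fin N')) (S : Set (ℕ → ℕ)), MeasurableSet S →
      P ({ω | σ ω = e} ∩ ν ⁻¹' S) = P {ω | σ ω = e} * P (ν ⁻¹' S))
    (m' m : ℕ) (hm' : 2 ≤ m') (hm'm : m' ≤ m) (hmN' : m ≤ N') :
    (P {ω | ((Finset.range m').image
        (fun i => parentMap (ν ω) (permVal (σ ω) i))).card ≤ m' - 1}).toReal
      ≥ ((m'.descFactorial 2 : ℝ) / (m.descFactorial 2 : ℝ))
        * (P {ω | ((Finset.range m).image
            (fun i => parentMap (ν ω) (permVal (σ ω) i))).card ≤ m - 1}).toReal := by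
  have hF : ∀ n, 0 < n → P {ω | ((Finset.range n).image
        (fun i => parentMap (ν ω) (permVal (σ ω) i))).card ≤ n - 1} =
      1 / (Nat.factorial N' : ℝ≥0∞) *
        ∑ e : Equiv.Perm (Fin N'), P (ν ⁻¹' {v | Coll n v e}) := by
    intro n hn
    have h1 : {ω | ((Finset.range n).image
        (fun i => parentMap (ν ω) (permVal (σ ω) i))).card ≤ n - 1} =
        ⋃ e ∈ (Finset.univ : Finset (Equiv.Perm (Fin N'))),
          ({ω | σ ω = e} ∩ ν ⁻¹' {v | Coll n v e}) := by
      ext ω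
      simp [card_le_iff_coll n hn]
    rw [h1, measure_biUnion_finset, Finset.mul_sum]
    · apply Finset.sum_congr rfl
      intro e _
      rw [hindep e _ (measurableSet_coll n e), hσunif]
    · intro a _ b _ hab
      apply Set.disjoint_left.mpr
      rintro ω ⟨h, _⟩ ⟨h', _⟩
      exact hab (h.symm.trans h')
    · intro e _
      exact (hσmeas e).inter (hνmeas (measurableSet_coll n e))
  rw [hF m' (by omega), hF m (by omega), ENNReal.toReal_mul, ENNReal.toReal_mul]
  set G : ℕ → ℝ := fun n =>
    (∑ e : Equiv.Perm (Fin N'), P (ν ⁻¹' {v | Coll n v e})).toReal with hG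
  have hfin : ∀ n, ∑ e : Equiv.Perm (Fin N'), P (ν ⁻¹' {v | Coll n v e}) ≠ ⊤ := fun n =>
    ENNReal.sum_ne_top.mpr fun e _ => measure_ne_top _ _
  have hstep : ∀ n, n < N' → ((n - 1 : ℕ) : ℝ) * G (n + 1) ≤ ((n + 1 : ℕ) : ℝ) * G n := by
    intro n hn
    have := ENNReal.toReal_mono (ENNReal.mul_ne_top (ENNReal.natCast_ne_top _) (hfin n))
      (step_sum P ν hνmeas n hn)
    rw [ENNReal.toReal_mul, ENNReal.toReal_mul, ENNReal.toReal_natCast,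
      ENNReal.toReal_natCast] at this
    exact this
  have hd : ∀ n : ℕ, 2 ≤ n → ((n.descFactorial 2 : ℕ) : ℝ) = n * (n - 1) := by
    intro n hn
    obtain ⟨k, rfl⟩ := Nat.exists_eq_add_of_le hn
    have : (2 + k).descFactorial 2 = (2 + k) * (1 + k) := by
      simp [Nat.descFactorial, Nat.add_comm, Nat.mul_comm, Nat.add_sub_assoc]
    rw [this]; push_cast; ring
  have main : ∀ n, m' ≤ n → n ≤ N' →
      ((m' : ℝ) * (m' - 1)) * G n ≤ ((n : ℝ) * (n - 1)) * G m' := by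
    intro n hn
    induction n, hn using Nat.le_induction with
    | base => intro _; exact le_rfl
    | succ n hn ih =>
      intro hn'
      have h1 := ih (by omega)
      have h2 := hstep n (by omega)
      have hn2 : (2 : ℝ) ≤ n := by exact_mod_cast hm'.trans hn
      have hm2 : (2 : ℝ) ≤ m' := by exact_mod_cast hm'
      rw [Nat.cast_sub (by omega)] at h2
      push_cast at h2 ⊢
      have hc : (0 : ℝ) ≤ (m' : ℝ) * (m' - 1) := mul_nonneg (by linarith) (by linarith)
      have h3 := mul_le_mul_of_nonneg_left h2 hc
      have h4 := mul_le_mul_of_nonneg_left h1 (by linarith : (0 : ℝ) ≤ n + 1)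
      have h5 : (0 : ℝ) < n - 1 := by linarith
      refine le_of_mul_le_mul_left ?_ h5
      linarith
  have hmain := main m hm'm hmN'
  rw [hd m' hm', hd m (by omega)]
  have hm2 : (2 : ℝ) ≤ m := by exact_mod_cast hm'.trans hm'm
  have hpos : (0 : ℝ) < (m : ℝ) * (m - 1) := mul_pos (by linarith) (by linarith)
  have hq : ((m' : ℝ) * (m' - 1)) / ((m : ℝ) * (m - 1)) * G m ≤ G m' := by
    rw [div_mul_eq_mul_div, div_le_iff₀ hpos]
    linarith
  have h0 : 0 ≤ (1 / (Nat.factorial N' : ℝ≥0∞)).toReal := ENNReal.toReal_nonneg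
  have := mul_le_mul_of_nonneg_left hq h0
  rw [ge_iff_le, mul_left_comm]
  exact this
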